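/- arXiv:2503.07208 — 2 statements merged into one kernel-verified Lean document; each statement's English description precedes it below -/
import Mathlib

section
/- Let T be a tournament, S ⊆ V(T), k a nonnegative integer, and s ∈ S a vertex that lies on no directed cycle of T on exactly three vertices. Then there exists F ⊆ A(T) with |F| ≤ k such that T ⊛ F is S-acyclic if and only if there exists F' ⊆ A(T − s) with |F'| ≤ k such that (T − s) ⊛ F' is (S \ {s})-acyclic, where T − s is the subtournament of T induced on V(T) \ {s}. -/
/-- A tournament on vertex type `V`, given by its arc set `A ⊆ V × V`:
no self-loops, and between any two distinct vertices exactly one arc. -/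
def IsTournament {V : Type*} (A : Set (V × V)) : Prop :=
  (∀ v : V, (v, v) ∉ A) ∧ ∀ u v : V, u ≠ v → ((u, v) ∈ A ↔ (v, u) ∉ A)

/-- `f : ZMod n → V` describes a directed cycle (on exactly `n` distinct
vertices) in the digraph with arc set `A`. -/
def IsCycle {V : Type*} (A : Set (V × V)) (n : ℕ) (f : ZMod n → V) : Prop :=
  2 ≤ n ∧ Function.Injective f ∧ ∀ i : ZMod n, (f i, f (i + 1)) ∈ A

/-- The digraph with arc set `A` has a directed cycle containing a vertex of `S`. -/
def HasSCycle {V : Type*} (A : Set (V × V)) (S : Set V) : Prop :=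
  ∃ (n : ℕ) (f : ZMod n → V), IsCycle A n f ∧ ∃ i, f i ∈ S

/-- The digraph with arc set `A` is `S`-acyclic: it has no `S`-cycle. -/
def SAcyclic {V : Type*} (A : Set (V × V)) (S : Set V) : Prop :=
  ¬ HasSCycle A S

/-- The arc set obtained from `A` by reversing all arcs of `F`:
`(A ∪ rev F) \ F` where `rev F = {(u,v) : (v,u) ∈ F}`. -/
def revArcs {V : Type*} (A F : Set (V × V)) : Set (V × V) :=
  (A ∪ {p | (p.2, p.1) ∈ F}) \ F

/-- The arc set of the subtournament obtained by deleting the vertex `s`: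
all arcs of `A` not incident to `s`. -/
def delVertex {V : Type*} (A : Set (V × V)) (s : V) : Set (V × V) :=
  {p ∈ A | p.1 ≠ s ∧ p.2 ≠ s}

/-- A predicate preserved by `+ 1` on `ZMod n`, `n ≠ 0`, holds everywhere once it holds somewhere. -/
theorem ZMod.forall_of_add_one {n : ℕ} [NeZero n] {P : ZMod n → Prop}
    (h : ∀ i, P i → P (i + 1)) {i : ZMod n} (hi : P i) (j : ZMod n) : P j := by
  have key : ∀ m : ℕ, P (i + m) := by
    intro m
    induction m with
    | zero => simpa using hi
    | succ m ih =>
      have := h _ ih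
      rwa [add_assoc, ← Nat.cast_succ] at this
  have := key (j - i).val
  rwa [ZMod.natCast_zmod_val, add_sub_cancel] at this

theorem SAcyclic.mono {V : Type*} {A B : Set (V × V)} {S S' : Set V}
    (h : SAcyclic B S') (hA : A ⊆ B) (hS : S ⊆ S') : SAcyclic A S := by
  rintro ⟨n, f, ⟨hn, hf, hc⟩, i, hi⟩
  exact h ⟨n, f, ⟨hn, hf, fun i => hA (hc i)⟩, i, hS hi⟩

/-- If `s` lies on no directed triangle, no arc leads from an out-neighbour of `s` to an
in-neighbour of `s`. -/
theorem notMem_of_no_triangle {V : Type*} {A : Set (V × V)} (hT : IsTournament A) {s : V}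
    (h : ¬ ∃ f : ZMod 3 → V, IsCycle A 3 f ∧ ∃ i, f i = s) {u v : V}
    (hu : (s, u) ∈ A) (hv : (v, s) ∈ A) : (u, v) ∉ A := by
  intro huv
  have hsu : s ≠ u := by rintro rfl; exact hT.1 _ hu
  have hvs : v ≠ s := by rintro rfl; exact hT.1 _ hv
  have huv' : u ≠ v := by rintro rfl; exact hT.1 _ huv
  refine h ⟨(![s, u, v] : Fin 3 → V), ⟨by norm_num, ?_, ?_⟩, (0 : Fin 3), rfl⟩
  · intro i j hij
    change Fin 3 at i j
    fin_cases i <;> fin_cases j <;> first | rfl | simp_all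
  · intro i
    change Fin 3 at i
    fin_cases i
    · exact hu
    · exact huv
    · exact hv

/-- if `s ∈ S` lies on no directed triangle of `T`, then `T` has a
set of at most `k` arcs whose reversal makes it `S`-acyclic iff `T - s` has a
set of at most `k` arcs whose reversal makes it `(S \ {s})`-acyclic. -/
theorem stmt_4 {V : Type*} [Fintype V] [DecidableEq V] (A : Set (V × V))
    (hT : IsTournament A) (S : Set V) (k : ℕ) (s : V) (hs : s ∈ S)
    (hsnotri : ¬ ∃ f : ZMod 3 → V, IsCycle A 3 f ∧ ∃ i, f i = s) :
    (∃ F ⊆ A, F.ncard ≤ k ∧ SAcyclic (revArcs A F) S) ↔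
      (∃ F' ⊆ delVertex A s, F'.ncard ≤ k ∧
        SAcyclic (revArcs (delVertex A s) F') (S \ {s})) := by
  constructor
  · rintro ⟨F, hFA, hFk, hF⟩
    refine ⟨F ∩ delVertex A s, Set.inter_subset_right,
      (Set.ncard_le_ncard Set.inter_subset_left F.toFinite).trans hFk,
      hF.mono ?_ Set.sdiff_subset⟩
    rintro ⟨u, v⟩ ⟨h | h, h'⟩
    · exact ⟨Or.inl h.1, fun hf => h' ⟨hf, h⟩⟩
    · refine ⟨Or.inr h.1, fun hf => ?_⟩
      exact h' ⟨hf, hFA hf, h.2.2.2, h.2.2.1⟩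
  · rintro ⟨F', hFA, hFk, hF⟩
    let F : Set (V × V) := {p ∈ F' | ¬ ((p.1, s) ∈ A ∧ (s, p.2) ∈ A)}
    have hFF : F ⊆ F' := Set.sep_subset _ _
    refine ⟨F, fun p hp => (hFA (hFF hp)).1,
      (Set.ncard_le_ncard hFF F'.toFinite).trans hFk, ?_⟩
    rintro ⟨n, f, ⟨hn, hf, hc⟩, i, hi⟩
    have : NeZero n := ⟨by omega⟩
    have asymm : ∀ u v, (u, v) ∈ A → (v, u) ∉ A := by
      intro u v h
      by_cases huv : u = v
      · exact huv ▸ hT.1 u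
      · exact (hT.2 u v huv).1 h
    have total : ∀ v, v ≠ s → (s, v) ∉ A → (v, s) ∈ A := fun v hv h =>
      (hT.2 v s hv).2 h
    have out_s : ∀ v, (s, v) ∈ revArcs A F → (s, v) ∈ A := by
      rintro v ⟨h | h, -⟩
      · exact h
      · exact absurd rfl (hFA (hFF h)).2.2
    have out_out : ∀ u v, (s, u) ∈ A → (u, v) ∈ revArcs A F → (s, v) ∈ A := by
      rintro u v hu ⟨h | h, -⟩
      · by_contra hv
        have hvs : v ≠ s := by rintro rfl; exact asymm _ _ hu h
        exact notMem_of_no_triangle hT hsnotri hu (total v hvs hv) h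
      · by_contra hv
        exact h.2 ⟨total v (hFA h.1).2.1 hv, hu⟩
    have all_out : ∀ i, (s, f i) ∈ A → ∀ j, (s, f j) ∈ A := fun i hi =>
      ZMod.forall_of_add_one (P := fun i => (s, f i) ∈ A)
        (fun i hi => out_out _ _ hi (hc i)) hi
    have ne_s : ∀ i, f i ≠ s := by
      intro i h
      have h1 := all_out (i + 1) (out_s _ (h ▸ hc i)) i
      exact hT.1 s (by rwa [h] at h1)
    have same_side : ∀ i j, ¬ ((f i, s) ∈ A ∧ (s, f j) ∈ A) := fun i j h =>
      asymm _ _ h.1 (all_out j h.2 i)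
    refine hF ⟨n, f, ⟨hn, hf, fun i => ?_⟩, i, hi, ne_s i⟩
    refine ⟨(hc i).1.imp (fun h => ⟨h, ne_s _, ne_s _⟩) (fun h => hFF h), fun h => ?_⟩
    exact (hc i).2 ⟨h, same_side _ _⟩
end

section
/- Let T be a tournament, S ⊆ V(T), k a positive integer, and e ∈ A(T) an arc that is contained in at least k+1 distinct S-triangles of T. Then there exists F ⊆ A(T) with |F| ≤ k such that T ⊛ F is S-acyclic if and only if there exists F' ⊆ A(T ⊛ {e}) with |F'| ≤ k−1 such that (T ⊛ {e}) ⊛ F' is S-acyclic. -/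
/-- `u, v, w` form an `S`-triangle containing the arc `(u,v)`: the three arcs
`(u,v), (v,w), (w,u)` are present and one of the vertices is in `S`.
The `S`-triangles containing the arc `(u,v)` are in bijection with such
third vertices `w`. -/
def IsSTriThrough {V : Type*} (A : Set (V × V)) (S : Set V) (u v w : V) : Prop :=
  (u, v) ∈ A ∧ (v, w) ∈ A ∧ (w, u) ∈ A ∧ (u ∈ S ∨ v ∈ S ∨ w ∈ S)

theorem IsTournament.notMem_swap {V : Type*} {A : Set (V × V)} (hT : IsTournament A)
    {u v : V} (h : (u, v) ∈ A) : (v, u) ∉ A := by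
  have huv : u ≠ v := by
    rintro rfl
    exact hT.1 u h
  exact (hT.2 u v huv).1 h

/-- A directed triangle meeting `S` is an `S`-cycle. -/
theorem hasSCycle_of_triangle {V : Type*} {A : Set (V × V)} {S : Set V} {u v w : V}
    (huv : u ≠ v) (hvw : v ≠ w) (hwu : w ≠ u) (h₁ : (u, v) ∈ A) (h₂ : (v, w) ∈ A)
    (h₃ : (w, u) ∈ A) (hS : u ∈ S ∨ v ∈ S ∨ w ∈ S) : HasSCycle A S := by
  refine ⟨3, (![u, v, w] : Fin 3 → V), ⟨by norm_num, ?_, ?_⟩, ?_⟩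
  · intro i j (hij : (![u, v, w] : Fin 3 → V) i = (![u, v, w] : Fin 3 → V) j)
    change Fin 3 at i j
    fin_cases i <;> fin_cases j <;> first | rfl | simp_all [eq_comm]
  · intro i
    change Fin 3 at i
    fin_cases i
    exacts [h₁, h₂, h₃]
  · rcases hS with h | h | h
    exacts [⟨(0 : Fin 3), h⟩, ⟨(1 : Fin 3), h⟩, ⟨(2 : Fin 3), h⟩]

/-- An arc lying in more than `F.ncard` many `S`-triangles belongs to every set `F` of arcs
whose reversal makes the tournament `S`-acyclic. -/
theorem mem_of_ncard_lt_of_sAcyclic {V : Type*} [Finite V] {A F : Set (V × V)}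
    (hT : IsTournament A) {S : Set V} {u v : V} (he : (u, v) ∈ A)
    (hlt : F.ncard < {w | IsSTriThrough A S u v w}.ncard) (hF : SAcyclic (revArcs A F) S) :
    (u, v) ∈ F := by
  classical
  by_contra hne
  have hhit : ∀ w, IsSTriThrough A S u v w → (v, w) ∈ F ∨ (w, u) ∈ F := by
    rintro w ⟨-, h₂, h₃, hS⟩
    by_contra! hw
    have ne_of_mem {x y : V} (h : (x, y) ∈ A) : x ≠ y := by
      rintro rfl
      exact hT.1 x h
    exact hF (hasSCycle_of_triangle (ne_of_mem he) (ne_of_mem h₂) (ne_of_mem h₃)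
      ⟨Or.inl he, hne⟩ ⟨Or.inl h₂, hw.1⟩ ⟨Or.inl h₃, hw.2⟩ hS)
  refine hlt.not_ge (Set.ncard_le_ncard_of_injOn
    (fun w => if (v, w) ∈ F then (v, w) else (w, u)) ?_ ?_ F.toFinite)
  · intro w hw
    have := hhit w hw
    grind
  · intro w hw w' hw' h
    have hvu := hT.notMem_swap he
    have h₁ : w ≠ u := by
      rintro rfl
      exact hvu hw.2.1
    have h₂ : w' ≠ u := by
      rintro rfl
      exact hvu hw'.2.1
    grind

/-- Reversing `F ∋ e` is the same as reversing `e` first and then the rest of `F`. -/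
theorem revArcs_revArcs_singleton_sdiff {V : Type*} {A F : Set (V × V)} (hT : IsTournament A)
    {u v : V} (he : (u, v) ∈ F) (hF : F ⊆ A) :
    revArcs (revArcs A {(u, v)}) (F \ {(u, v)}) = revArcs A F := by
  have hvu : (v, u) ∉ F := fun h => hT.notMem_swap (hF he) (hF h)
  ext ⟨x, y⟩
  simp only [revArcs, Set.mem_sdiff, Set.mem_union, Set.mem_ofPred_eq, Set.mem_singleton_iff,
    Prod.mk.injEq]
  grind

/-- Reversing an arc `e` and later reversing it back has no effect. -/
theorem revArcs_revArcs_singleton_of_swap_mem {V : Type*} {A F : Set (V × V)}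
    (hT : IsTournament A) {u v : V} (he : (u, v) ∈ A) (hvu : (v, u) ∈ F)
    (hF : F ⊆ revArcs A {(u, v)}) :
    revArcs (revArcs A {(u, v)}) F = revArcs A (F \ {(v, u)}) := by
  have huv : (u, v) ∉ F := fun h => (hF h).2 rfl
  have hvuA := hT.notMem_swap he
  ext ⟨x, y⟩
  simp only [revArcs, Set.mem_sdiff, Set.mem_union, Set.mem_ofPred_eq, Set.mem_singleton_iff,
    Prod.mk.injEq]
  grind

theorem subset_insert_swap_of_subset_revArcs {V : Type*} {A F : Set (V × V)} {u v : V}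
    (hF : F ⊆ revArcs A {(u, v)}) : F ⊆ insert (v, u) A := by
  rintro ⟨x, y⟩ h
  have := (hF h).1
  simp only [Set.mem_union, Set.mem_ofPred_eq, Set.mem_singleton_iff, Prod.mk.injEq] at this
  grind

/-- if an arc `e = (u,v)` of `T` is contained in at least `k+1`
distinct `S`-triangles, then `T` has at most `k` arcs whose reversal makes it
`S`-acyclic iff `T ⊛ {e}` has at most `k-1` arcs whose reversal makes it
`S`-acyclic. -/
theorem stmt_5 {V : Type*} [Fintype V] (A : Set (V × V)) (hT : IsTournament A)
    (S : Set V) (k : ℕ) (hk : 1 ≤ k) (u v : V) (he : (u, v) ∈ A)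
    (hmany : k + 1 ≤ {w | IsSTriThrough A S u v w}.ncard) :
    (∃ F ⊆ A, F.ncard ≤ k ∧ SAcyclic (revArcs A F) S) ↔
      (∃ F' ⊆ revArcs A {(u, v)}, F'.ncard ≤ k - 1 ∧
        SAcyclic (revArcs (revArcs A {(u, v)}) F') S) := by
  constructor
  · rintro ⟨F, hFA, hcard, hF⟩
    have heF := mem_of_ncard_lt_of_sAcyclic hT he (by omega) hF
    refine ⟨F \ {(u, v)}, fun p hp => ⟨Or.inl (hFA hp.1), hp.2⟩, ?_, ?_⟩
    · rw [Set.ncard_sdiff_singleton_of_mem heF]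
      omega
    · rwa [revArcs_revArcs_singleton_sdiff hT heF hFA]
  · rintro ⟨F, hFA, hcard, hF⟩
    have hsub := subset_insert_swap_of_subset_revArcs hFA
    by_cases hvu : (v, u) ∈ F
    · refine ⟨F \ {(v, u)}, fun p hp => (hsub hp.1).resolve_left hp.2, ?_, ?_⟩
      · have := Set.ncard_sdiff_singleton_le F (v, u)
        omega
      · rwa [← revArcs_revArcs_singleton_of_swap_mem hT he hvu hFA]
    · have huv : (u, v) ∉ F := fun h => (hFA h).2 rfl
      have hins : insert (u, v) F ⊆ A := Set.insert_subset he fun p hp =>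
        (hsub hp).resolve_left fun h => hvu (h ▸ hp)
      refine ⟨insert (u, v) F, hins, ?_, ?_⟩
      · have := Set.ncard_insert_le (u, v) F
        omega
      · rwa [← revArcs_revArcs_singleton_sdiff hT (Set.mem_insert _ _) hins,
          Set.insert_sdiff_self_of_notMem huv]
end
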